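/- The function L : 𝔇 → ℝ defined by L(x) = Σ_{i,v} x_v^i log(x_v^i) − (1/2) Σ_{i,j,v} α_v^{ij} x_v^i x_v^j (with 0·log 0 = 0) is a strict Lyapunov function for F: for every x0 ∈ 𝔇 \ F^{-1}(0) and every map x : [0,∞) → 𝔇 with x(0) = x0 that is differentiable with x'(t) = F(x(t)) for all t ≥ 0, the function t ↦ L(x(t)) is strictly decreasing on [0,∞). -/

import Mathlib

open Filter

/-- The simplex product `𝔇 = Δ^m`: each walk's coordinates are nonnegative and sum to 1. -/
def simplexD (d m : ℕ) : Set (Fin m → Fin d → ℝ) :=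
  {x | ∀ i, (∀ v, 0 ≤ x i v) ∧ (∑ v, x i v) = 1}

/-- The map `π` with `π_v^i(x) = exp(Σ_j α_v^{ij} x_v^j) / Σ_u exp(Σ_j α_u^{ij} x_u^j)`. -/
noncomputable def piMap (d m : ℕ) (α : Fin d → Fin m → Fin m → ℝ)
    (x : Fin m → Fin d → ℝ) : Fin m → Fin d → ℝ :=
  fun i v => Real.exp (∑ j, α v i j * x j v) / ∑ u, Real.exp (∑ j, α u i j * x j u)

/-- The vector field `F(x) = -x + π(x)`. -/
noncomputable def FF (d m : ℕ) (α : Fin d → Fin m → Fin m → ℝ)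
    (x : Fin m → Fin d → ℝ) : Fin m → Fin d → ℝ :=
  fun i v => -(x i v) + piMap d m α x i v

/-- The Lyapunov function
`L(x) = Σ_{i,v} x_v^i log x_v^i - (1/2) Σ_{i,j,v} α_v^{ij} x_v^i x_v^j`
(note `Real.log 0 = 0`, so the convention `0 log 0 = 0` holds). -/
noncomputable def LFun (d m : ℕ) (α : Fin d → Fin m → Fin m → ℝ)
    (x : Fin m → Fin d → ℝ) : ℝ :=
  (∑ i, ∑ v, x i v * Real.log (x i v))
    - (1 / 2) * ∑ i, ∑ j, ∑ v, α v i j * x i v * x j v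

section

variable {d m : ℕ} {α : Fin d → Fin m → Fin m → ℝ}

lemma sum_exp_pos (hd : 2 ≤ d) (a : Fin d → ℝ) : 0 < ∑ u, Real.exp (a u) :=
  haveI : NeZero d := ⟨by omega⟩
  Finset.sum_pos (fun _ _ => Real.exp_pos _) Finset.univ_nonempty

lemma piMap_pos (hd : 2 ≤ d) (x : Fin m → Fin d → ℝ) (i : Fin m) (v : Fin d) :
    0 < piMap d m α x i v :=
  div_pos (Real.exp_pos _) (sum_exp_pos hd _)

lemma sum_piMap (hd : 2 ≤ d) (x : Fin m → Fin d → ℝ) (i : Fin m) :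
    ∑ v, piMap d m α x i v = 1 := by
  unfold piMap
  rw [← Finset.sum_div]
  exact div_self (sum_exp_pos hd _).ne'

lemma sum_FF_eq_zero (hd : 2 ≤ d) {x : Fin m → Fin d → ℝ} (hx : x ∈ simplexD d m) (i : Fin m) :
    ∑ v, FF d m α x i v = 0 := by
  simp only [FF, Finset.sum_add_distrib, Finset.sum_neg_distrib, sum_piMap hd, (hx i).2]
  norm_num

lemma contDiff_FF (hd : 2 ≤ d) : ContDiff ℝ 1 (FF d m α) := by
  unfold FF piMap
  refine contDiff_pi.2 fun i => contDiff_pi.2 fun v => ?_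
  refine ContDiff.add (by fun_prop) (ContDiff.div (by fun_prop) (by fun_prop) ?_)
  exact fun x => (sum_exp_pos hd _).ne'

lemma simplexD_subset_closedBall : simplexD d m ⊆ Metric.closedBall 0 1 := by
  intro x hx
  rw [mem_closedBall_zero_iff, pi_norm_le_iff_of_nonneg zero_le_one]
  intro i
  rw [pi_norm_le_iff_of_nonneg zero_le_one]
  intro v
  rw [Real.norm_of_nonneg ((hx i).1 v), ← (hx i).2]
  exact Finset.single_le_sum (fun u _ => (hx i).1 u) (Finset.mem_univ v)

/-- A solution that does not start at an equilibrium never reaches one. -/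
lemma FF_ne_zero_of_solution (hd : 2 ≤ d) {x : ℝ → Fin m → Fin d → ℝ}
    (h0 : FF d m α (x 0) ≠ 0) (hmem : ∀ t, 0 ≤ t → x t ∈ simplexD d m)
    (hder : ∀ t, 0 ≤ t → HasDerivAt x (FF d m α (x t)) t) {t : ℝ} (ht : 0 ≤ t) :
    FF d m α (x t) ≠ 0 := by
  intro hz
  obtain ⟨K, hK⟩ := (contDiff_FF (α := α) hd).contDiffOn.exists_lipschitzOnWith one_ne_zero
    (convex_closedBall (0 : Fin m → Fin d → ℝ) 1) (isCompact_closedBall 0 1)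
  have heq : Set.EqOn x (fun _ => x t) (Set.Icc 0 t) :=
    ODE_solution_unique_of_mem_Icc_left (v := fun _ => FF d m α)
      (s := fun _ => Metric.closedBall 0 1) (fun _ _ => hK)
      (fun s hs => (hder s hs.1).continuousAt.continuousWithinAt)
      (fun s hs => (hder s hs.1.le).hasDerivWithinAt)
      (fun s hs => simplexD_subset_closedBall (hmem s hs.1.le))
      continuousOn_const
      (fun s _ => by simpa only [hz] using hasDerivWithinAt_const s _ (x t))
      (fun _ _ => simplexD_subset_closedBall (hmem t ht)) rfl
  exact h0 (by rw [heq ⟨le_rfl, ht⟩, hz])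

/-- Solutions lie in the interior of the simplex product at positive times. -/
lemma pos_of_solution (hd : 2 ≤ d) {x : ℝ → Fin m → Fin d → ℝ}
    (hmem : ∀ t, 0 ≤ t → x t ∈ simplexD d m)
    (hder : ∀ t, 0 ≤ t → HasDerivAt x (FF d m α (x t)) t) {t : ℝ} (ht : 0 < t)
    (i : Fin m) (v : Fin d) : 0 < x t i v := by
  refine ((hmem t ht.le i).1 v).lt_of_ne' fun hz => ?_
  have hmin : IsLocalMin (fun s => x s i v) t := by
    filter_upwards [lt_mem_nhds ht] with s hs
    rw [hz]
    exact (hmem s hs.le i).1 v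
  have h := hmin.hasDerivAt_eq_zero (hasDerivAt_pi.1 (hasDerivAt_pi.1 (hder t ht.le) i) v)
  have hp := piMap_pos (α := α) hd (x t) i v
  simp only [FF, hz] at h
  linarith

lemma continuous_LFun : Continuous (LFun d m α) := by
  unfold LFun
  refine Continuous.sub ?_ (by fun_prop)
  refine continuous_finsetSum _ fun i _ => continuous_finsetSum _ fun v _ => ?_
  exact Real.continuous_mul_log.comp (by fun_prop)

lemma hasDerivAt_LFun_comp (hsym : ∀ v i j, α v i j = α v j i) {x : ℝ → Fin m → Fin d → ℝ}
    {x' : Fin m → Fin d → ℝ} {t : ℝ} (hx : HasDerivAt x x' t) (hpos : ∀ i v, 0 < x t i v) :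
    HasDerivAt (fun s => LFun d m α (x s))
      (∑ i, ∑ v, (Real.log (x t i v) + 1 - ∑ j, α v i j * x t j v) * x' i v) t := by
  have hc : ∀ i v, HasDerivAt (fun s => x s i v) (x' i v) t := fun i v =>
    hasDerivAt_pi.1 (hasDerivAt_pi.1 hx i) v
  have h1 : HasDerivAt (fun s => ∑ i, ∑ v, x s i v * Real.log (x s i v))
      (∑ i, ∑ v, (Real.log (x t i v) + 1) * x' i v) t :=
    HasDerivAt.fun_sum fun i _ => HasDerivAt.fun_sum fun v _ =>
      HasDerivAt.comp t (h₂ := fun y => y * Real.log y) (Real.hasDerivAt_mul_log (hpos i v).ne') (hc i v)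
  have h2 : HasDerivAt (fun s => ∑ i, ∑ j, ∑ v, α v i j * x s i v * x s j v)
      (∑ i, ∑ j, ∑ v, (α v i j * x' i v * x t j v + α v i j * x t i v * x' j v)) t :=
    HasDerivAt.fun_sum fun i _ => HasDerivAt.fun_sum fun j _ => HasDerivAt.fun_sum fun v _ =>
      ((hc i v).const_mul _).mul (hc j v)
  have hswap : ∑ i, ∑ j, ∑ v, α v i j * x t i v * x' j v =
      ∑ i, ∑ j, ∑ v, α v i j * x' i v * x t j v := by
    rw [Finset.sum_comm]
    refine Finset.sum_congr rfl fun i _ => Finset.sum_congr rfl fun j _ =>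
      Finset.sum_congr rfl fun v _ => ?_
    rw [hsym v j i]
    ring
  have hquad : ∑ i, ∑ j, ∑ v, α v i j * x' i v * x t j v =
      ∑ i, ∑ v, (∑ j, α v i j * x t j v) * x' i v := by
    refine Finset.sum_congr rfl fun i _ => ?_
    rw [Finset.sum_comm]
    refine Finset.sum_congr rfl fun v _ => ?_
    rw [Finset.sum_mul]
    exact Finset.sum_congr rfl fun j _ => by ring
  refine (h1.sub (h2.const_mul (1 / 2))).congr_deriv ?_
  simp only [Finset.sum_add_distrib, hswap, hquad, sub_mul, Finset.sum_sub_distrib]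
  ring

lemma log_sub_log_mul_sub_neg {a b : ℝ} (ha : 0 < a) (hb : 0 < b) (hab : a ≠ b) :
    (Real.log a - Real.log b) * (b - a) < 0 := by
  rcases hab.lt_or_gt with h | h
  · exact mul_neg_of_neg_of_pos (sub_neg.2 (Real.log_lt_log ha h)) (sub_pos.2 h)
  · exact mul_neg_of_pos_of_neg (sub_pos.2 (Real.log_lt_log hb h)) (sub_neg.2 h)

lemma sum_grad_LFun_mul_FF_neg (hd : 2 ≤ d) {x : Fin m → Fin d → ℝ} (hx : x ∈ simplexD d m)
    (hpos : ∀ i v, 0 < x i v) (hne : FF d m α x ≠ 0) :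
    ∑ i, ∑ v, (Real.log (x i v) + 1 - ∑ j, α v i j * x j v) * FF d m α x i v < 0 := by
  have hlog : ∀ i v, Real.log (piMap d m α x i v) =
      ∑ j, α v i j * x j v - Real.log (∑ u, Real.exp (∑ j, α u i j * x j u)) := fun i v => by
    rw [piMap, Real.log_div (Real.exp_pos _).ne' (sum_exp_pos hd _).ne', Real.log_exp]
  have hrw : ∑ i, ∑ v, (Real.log (x i v) + 1 - ∑ j, α v i j * x j v) * FF d m α x i v =
      ∑ i, ∑ v, (Real.log (x i v) - Real.log (piMap d m α x i v)) *
        (piMap d m α x i v - x i v) := by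
    refine Finset.sum_congr rfl fun i _ => ?_
    rw [← sub_eq_zero, ← Finset.sum_sub_distrib]
    rw [← mul_zero (1 - Real.log (∑ u, Real.exp (∑ j, α u i j * x j u))),
      ← sum_FF_eq_zero (α := α) hd hx i, Finset.mul_sum]
    refine Finset.sum_congr rfl fun v _ => ?_
    rw [hlog]
    simp only [FF]
    ring
  have hle : ∀ i v, (Real.log (x i v) - Real.log (piMap d m α x i v)) *
      (piMap d m α x i v - x i v) ≤ 0 := fun i v => by
    by_cases h : x i v = piMap d m α x i v
    · simp [← h]
    · exact (log_sub_log_mul_sub_neg (hpos i v) (piMap_pos hd x i v) h).le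
  obtain ⟨i, hi⟩ := Function.ne_iff.1 hne
  obtain ⟨v, hv⟩ := Function.ne_iff.1 hi
  have hv' : x i v ≠ piMap d m α x i v := fun h => hv (by simp [FF, ← h])
  rw [hrw]
  refine Finset.sum_neg' (fun i _ => Finset.sum_nonpos fun v _ => hle i v)
    ⟨i, Finset.mem_univ i, Finset.sum_neg' (fun v _ => hle i v) ⟨v, Finset.mem_univ v, ?_⟩⟩
  exact log_sub_log_mul_sub_neg (hpos i v) (piMap_pos hd x i v) hv'

end

/-- `L` is a strict Lyapunov function for `F`: along any solution of `x' = F(x)` starting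
in `𝔇 \ F⁻¹(0)`, the function `t ↦ L(x(t))` is strictly decreasing on `[0, ∞)`. -/
theorem strict_lyapunov (d m : ℕ) (hd : 2 ≤ d) (hm : 2 ≤ m)
    (α : Fin d → Fin m → Fin m → ℝ) (hsym : ∀ v i j, α v i j = α v j i)
    (x0 : Fin m → Fin d → ℝ) (hx0mem : x0 ∈ simplexD d m)
    (hx0ne : FF d m α x0 ≠ 0)
    (x : ℝ → Fin m → Fin d → ℝ) (hx0 : x 0 = x0)
    (hmem : ∀ t, 0 ≤ t → x t ∈ simplexD d m)
    (hder : ∀ t, 0 ≤ t → HasDerivAt x (FF d m α (x t)) t) :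
    StrictAntiOn (fun t => LFun d m α (x t)) (Set.Ici 0) := by
  subst hx0
  refine strictAntiOn_of_hasDerivWithinAt_neg (convex_Ici 0)
    (f' := fun t => ∑ i, ∑ v, (Real.log (x t i v) + 1 - ∑ j, α v i j * x t j v) *
      FF d m α (x t) i v)
    (fun t ht => (continuous_LFun.continuousAt.comp (hder t ht).continuousAt).continuousWithinAt)
    (fun t ht => ?_) (fun t ht => ?_)
  all_goals
    rw [interior_Ici] at ht
    have hpos := pos_of_solution hd hmem hder ht
  · exact (hasDerivAt_LFun_comp hsym (hder t ht.le) hpos).hasDerivWithinAt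
  · exact sum_grad_LFun_mul_FF_neg hd (hmem t ht.le) hpos
      (FF_ne_zero_of_solution hd hx0ne hmem hder ht.le)
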